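/- arXiv:2512.01736 — 2 statements merged into one kernel-verified Lean document; each statement's English description precedes it below -/
import Mathlib

section
/- Let Γ = (G, σ) be a connected signed graph on n > 2 vertices, let R = {u₁,…,u_k} ⊆ V(Γ), and suppose the edges of the induced signed subgraph Γ[R] form r pairwise disjoint edges (a matching of size r). Then μ₁(Γ) + ⋯ + μ_k(Γ) ≥ Σ_{i=1}^k d_Γ(uᵢ) + k − r, where μ₁ ≥ ⋯ ≥ μₙ are the Laplacian eigenvalues. -/
open Matrix Polynomial Finset

lemma aux_perm {n : ℕ} (f g : Fin n → ℝ)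
    (h : Multiset.map f univ.val = Multiset.map g univ.val) :
    ∃ e : Fin n ≃ Fin n, ∀ i, g (e i) = f i := by
  classical
  have key : ∀ c, Nonempty ({a // f a = c} ≃ {a // g a = c}) := by
    intro c
    refine ⟨Fintype.equivOfCardEq ?_⟩
    have := congrArg (Multiset.count c) h
    rw [Multiset.count_map, Multiset.count_map] at this
    rw [Fintype.card_subtype, Fintype.card_subtype]
    simpa [Finset.card_def, eq_comm] using this
  let E := fun c => (key c).some
  exact ⟨Equiv.ofFiberEquiv E, fun i => Equiv.ofFiberEquiv_map E i⟩

lemma aux_eigenbasis {n : ℕ} (L : Matrix (Fin n) (Fin n) ℝ) (hL : L.IsHermitian)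
    (μ : Fin n → ℝ) (hchar : L.charpoly = ∏ i, (X - C (μ i))) :
    ∃ b : OrthonormalBasis (Fin n) ℝ (EuclideanSpace ℝ (Fin n)),
      ∀ i, L.mulVec (b i).ofLp = μ i • (b i).ofLp := by
  have h1 := hL.roots_charpoly_eq_eigenvalues
  rw [hchar] at h1
  have h2 : (∏ i, (X - C (μ i))).roots = Multiset.map μ univ.val := by
    have := Polynomial.roots_multiset_prod_X_sub_C (Multiset.map μ univ.val)
    rw [Multiset.map_map] at this
    exact this
  rw [h2] at h1
  obtain ⟨e, he⟩ := aux_perm μ (hL.eigenvalues) (by simpa using h1)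
  refine ⟨hL.eigenvectorBasis.reindex e.symm, fun i => ?_⟩
  rw [OrthonormalBasis.reindex_apply, Equiv.symm_symm, hL.mulVec_eigenvectorBasis, he]

lemma aux_weights {n k : ℕ} (hn : 0 < n) (hk : k ≤ n) (μ w : Fin n → ℝ) (hmono : Antitone μ)
    (hμ : ∀ i, 0 ≤ μ i) (hw0 : ∀ i, 0 ≤ w i) (hw1 : ∀ i, w i ≤ 1) (hw : ∑ i, w i ≤ k) :
    ∑ i, μ i * w i ≤ ∑ i ∈ univ.filter (fun i : Fin n => (i : ℕ) < k), μ i := by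
  set c := μ ⟨k - 1, by omega⟩ with hc
  have hc0 : 0 ≤ c := hμ _
  have hcard : (∑ i : Fin n, if (i : ℕ) < k then (1 : ℝ) else 0) = k := by
    rw [Finset.sum_ite]
    simp [Fin.card_filter_val_lt, hk]
  have h : ∀ i : Fin n, μ i * w i ≤ (if (i : ℕ) < k then μ i else 0)
      - c * ((if (i : ℕ) < k then 1 else 0) - w i) := by
    intro i
    split_ifs with hi
    · have : c ≤ μ i := hmono (by rw [Fin.le_def]; simp; omega)
      nlinarith [hw1 i]
    · have : μ i ≤ c := hmono (by rw [Fin.le_def]; simp; omega)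
      nlinarith [hw0 i]
  have h' := Finset.sum_le_sum (fun i (_ : i ∈ univ) => h i)
  rw [Finset.sum_sub_distrib, ← Finset.mul_sum, Finset.sum_sub_distrib, hcard] at h'
  rw [Finset.sum_filter]
  nlinarith [mul_nonneg hc0 (sub_nonneg.2 hw)]

lemma aux_quad {n : ℕ} (L : Matrix (Fin n) (Fin n) ℝ) (μ : Fin n → ℝ)
    (b : OrthonormalBasis (Fin n) ℝ (EuclideanSpace ℝ (Fin n)))
    (hb : ∀ i, L.mulVec (b i).ofLp = μ i • (b i).ofLp) (q : EuclideanSpace ℝ (Fin n)) :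
    q.ofLp ⬝ᵥ L.mulVec q.ofLp = ∑ i, μ i * (inner ℝ q (b i)) ^ 2 := by
  have h1 : L.mulVec q.ofLp = (∑ i, (inner ℝ (b i) q * μ i) • b i : EuclideanSpace ℝ (Fin n)).ofLp := by
    conv_lhs => rw [← b.sum_repr' q]
    simp only [WithLp.ofLp_sum, WithLp.ofLp_smul, Matrix.mulVec_sum, Matrix.mulVec_smul, hb,
      smul_smul]
  have h2 : ∀ y : EuclideanSpace ℝ (Fin n), q.ofLp ⬝ᵥ y.ofLp = inner ℝ q y := by
    intro y
    rw [EuclideanSpace.inner_eq_star_dotProduct, dotProduct_comm]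
    simp
  rw [h1, h2, inner_sum]
  refine Finset.sum_congr rfl fun i _ => ?_
  rw [inner_smul_right, real_inner_comm q (b i)]
  ring

lemma aux_main {n k : ℕ} (hn : 0 < n) (hk : k ≤ n) (L : Matrix (Fin n) (Fin n) ℝ)
    (hL : L.IsHermitian) (μ : Fin n → ℝ) (hmono : Antitone μ)
    (hchar : L.charpoly = ∏ i, (X - C (μ i))) (R : Finset (Fin n)) (hR : R.card = k)
    (z : Fin n → EuclideanSpace ℝ (Fin n))
    (hz : ∀ v : EuclideanSpace ℝ (Fin n),
      ∑ u ∈ R, (inner ℝ v (z u)) ^ 2 ≤ v.ofLp ⬝ᵥ L.mulVec v.ofLp) :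
    ∑ u ∈ R, ‖z u‖ ^ 2 ≤ ∑ i ∈ univ.filter (fun i : Fin n => (i : ℕ) < k), μ i := by
  classical
  obtain ⟨b, hb⟩ := aux_eigenbasis L hL μ hchar
  have hquad := aux_quad L μ b hb
  have hμ : ∀ i, 0 ≤ μ i := by
    intro i
    have h1 := hz (b i)
    rw [hb i, dotProduct_smul] at h1
    have h2 : (b i).ofLp ⬝ᵥ (b i).ofLp = 1 := by
      have : inner ℝ (b i) (b i) = (1 : ℝ) := by
        rw [real_inner_self_eq_norm_sq, b.norm_eq_one]; norm_num
      rw [EuclideanSpace.inner_eq_star_dotProduct] at this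
      simpa using this
    rw [h2] at h1
    have h3 : 0 ≤ ∑ u ∈ R, (inner ℝ (b i) (z u)) ^ 2 := Finset.sum_nonneg fun _ _ => sq_nonneg _
    simpa using h3.trans h1
  let W : Submodule ℝ (EuclideanSpace ℝ (Fin n)) := Submodule.span ℝ ((R.image z : Finset _) : Set _)
  have hWk : Module.finrank ℝ W ≤ k :=
    (finrank_span_finset_le_card (R := ℝ) (R.image z)).trans (hR ▸ Finset.card_image_le)
  let q := stdOrthonormalBasis ℝ W
  have hq : Orthonormal ℝ (fun j => (q j : EuclideanSpace ℝ (Fin n))) :=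
    q.orthonormal.comp_linearIsometry W.subtypeₗᵢ
  have hzn : ∀ u ∈ R, ‖z u‖ ^ 2 = ∑ j, (inner ℝ (q j : EuclideanSpace ℝ (Fin n)) (z u)) ^ 2 := by
    intro u hu
    have hzW : z u ∈ W := Submodule.subset_span (by simpa using ⟨u, hu, rfl⟩)
    have := q.sum_sq_norm_inner_right ⟨z u, hzW⟩
    simp only [Submodule.coe_inner, Real.norm_eq_abs, sq_abs, Submodule.coe_norm] at this
    exact this.symm
  let w : Fin n → ℝ := fun i => ∑ j, (inner ℝ (q j : EuclideanSpace ℝ (Fin n)) (b i)) ^ 2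
  calc ∑ u ∈ R, ‖z u‖ ^ 2
      = ∑ j, ∑ u ∈ R, (inner ℝ (q j : EuclideanSpace ℝ (Fin n)) (z u)) ^ 2 := by
        rw [Finset.sum_comm]; exact Finset.sum_congr rfl hzn
    _ ≤ ∑ j, ∑ i, μ i * (inner ℝ (q j : EuclideanSpace ℝ (Fin n)) (b i)) ^ 2 :=
        Finset.sum_le_sum fun j _ => (hz _).trans_eq (hquad _)
    _ = ∑ i, μ i * w i := by
        rw [Finset.sum_comm]; simp only [w, Finset.mul_sum]
    _ ≤ _ := by
        refine aux_weights hn hk μ w hmono hμ (fun i => Finset.sum_nonneg fun _ _ => sq_nonneg _) ?_ ?_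
        · intro i
          have := hq.sum_inner_products_le (b i) (s := univ)
          simpa [b.norm_eq_one] using this
        · have : ∑ i, w i = Module.finrank ℝ W := by
            simp only [w]
            rw [Finset.sum_comm]
            have : ∀ j, ∑ i, (inner ℝ (q j : EuclideanSpace ℝ (Fin n)) (b i)) ^ 2 = 1 := by
              intro j
              have := b.sum_sq_norm_inner_left (q j : EuclideanSpace ℝ (Fin n))
              have h1 : ‖(q j : EuclideanSpace ℝ (Fin n))‖ = 1 := hq.1 j
              rw [h1] at this
              simpa using this
            simp [this]
          rw [this]
          exact_mod_cast hWk

lemma aux_two {n : ℕ} (hn : 2 < n) (G : SimpleGraph (Fin n)) [DecidableRel G.Adj]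
    (hconn : G.Connected) (a b : Fin n) (hab : G.Adj a b) (ha : G.degree a < 2) :
    2 ≤ G.degree b := by
  by_contra hb
  push Not at hb
  have key : ∀ x y, G.Adj x y → G.degree x < 2 → ∀ z, G.Adj x z → z = y := by
    intro x y hxy hx z hxz
    have : (G.neighborFinset x).card ≤ 1 := by
      rw [G.card_neighborFinset_eq_degree]; omega
    exact Finset.card_le_one.1 this z (by simpa using hxz) y (by simpa using hxy)
  have hreach : ∀ x, x = a ∨ x = b := by
    intro x
    obtain ⟨p⟩ := hconn.preconnected a x
    have step : ∀ {y x : Fin n} (_ : G.Walk y x), (y = a ∨ y = b) → (x = a ∨ x = b) := by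
      intro y x p
      induction p with
      | nil => exact id
      | cons h p ih =>
        intro hy
        apply ih
        rcases hy with rfl | rfl
        · exact Or.inr (key _ _ hab ha _ h)
        · exact Or.inl (key _ _ hab.symm hb _ h)
    exact step p (Or.inl rfl)
  have : (univ : Finset (Fin n)) ⊆ {a, b} := fun x _ => by simpa using hreach x
  have h2 := (Finset.card_le_card this).trans Finset.card_le_two
  simp at h2
  omega

lemma aux_lower {n : ℕ} (G : SimpleGraph (Fin n)) [DecidableRel G.Adj]
    (σ : Fin n → Fin n → ℝ)
    (hσ : ∀ i j, G.Adj i j → σ i j = 1 ∨ σ i j = -1)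
    (hsym : ∀ i j, σ i j = σ j i)
    (L : Matrix (Fin n) (Fin n) ℝ)
    (hL : L = fun i j => (if i = j then (G.degree i : ℝ) else 0) -
      (if G.Adj i j then σ i j else 0))
    (R : Finset (Fin n)) (S : Fin n → Finset (Fin n))
    (hS : ∀ u, ∀ w ∈ S u, G.Adj u w)
    (hdis : ∀ a ∈ R, ∀ b ∈ R, b ∈ S a → a ∉ S b) (v : Fin n → ℝ) :
    ∑ u ∈ R, ∑ w ∈ S u, (v u - σ u w * v w) ^ 2 ≤ v ⬝ᵥ L.mulVec v := by
  classical
  let f : Fin n → Fin n → ℝ := fun a b => if G.Adj a b then (v a - σ a b * v b) ^ 2 else 0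
  have hf0 : ∀ a b, 0 ≤ f a b := by
    intro a b; simp only [f]; split_ifs <;> positivity
  have hfs : ∀ a b, f a b = f b a := by
    intro a b
    simp only [f, G.adj_comm a b]
    split_ifs with h
    · rw [hsym a b]
      rcases hσ b a h with h | h <;> rw [h] <;> ring
    · rfl
  let T : Fin n → Fin n → ℝ := fun a b => if a ∈ R ∧ b ∈ S a then 1 else 0
  have hT : ∀ a b, T a b + T b a ≤ 1 := by
    intro a b
    simp only [T]
    have := hdis a
    have := hS a b
    split_ifs with h1 h2 h2
    · exact absurd h2.2 (hdis a h1.1 b h2.1 h1.2)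
    all_goals norm_num
  have h1 : ∑ u ∈ R, ∑ w ∈ S u, (v u - σ u w * v w) ^ 2 = ∑ a, ∑ b, T a b * f a b := by
    rw [← Finset.sum_filter_add_sum_filter_not univ (· ∈ R)]
    have e1 : ∑ x with x ∉ R, ∑ b, T x b * f x b = 0 := by
      refine Finset.sum_eq_zero fun x hx => Finset.sum_eq_zero fun y _ => ?_
      have : x ∉ R := by simpa using hx
      simp [T, this]
    rw [e1, add_zero, Finset.filter_univ_mem]
    refine Finset.sum_congr rfl fun u hu => ?_
    simp only [T, hu, true_and, ite_mul, one_mul, zero_mul, Finset.sum_ite_mem, Finset.univ_inter]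
    refine Finset.sum_congr rfl fun w hw => ?_
    simp [f, hS u w hw]
  have h2 : v ⬝ᵥ L.mulVec v = (∑ a, ∑ b, f a b) / 2 := by
    have e0 : v ⬝ᵥ L.mulVec v = ∑ a, ∑ b, (if G.Adj a b then v a ^ 2 - σ a b * v a * v b else 0) := by
      simp only [dotProduct, Matrix.mulVec, hL]
      refine Finset.sum_congr rfl fun a _ => ?_
      have e3 : (G.degree a : ℝ) = ∑ b, if G.Adj a b then (1:ℝ) else 0 := by
        rw [← G.card_neighborFinset_eq_degree, Finset.sum_ite]
        simp [SimpleGraph.neighborFinset_eq_filter]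
      have e4 : ∑ b, ((if a = b then (G.degree a : ℝ) else 0) - (if G.Adj a b then σ a b else 0)) * v b
          = (G.degree a : ℝ) * v a - ∑ b, (if G.Adj a b then σ a b else 0) * v b := by
        simp [sub_mul, Finset.sum_sub_distrib]
      rw [e4, e3, Finset.sum_mul, ← Finset.sum_sub_distrib, Finset.mul_sum]
      refine Finset.sum_congr rfl fun b _ => ?_
      split_ifs <;> ring
    have e1 : v ⬝ᵥ L.mulVec v = ∑ a, ∑ b, (if G.Adj a b then v b ^ 2 - σ a b * v a * v b else 0) := by
      rw [e0, Finset.sum_comm]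
      refine Finset.sum_congr rfl fun a _ => Finset.sum_congr rfl fun b _ => ?_
      simp only [G.adj_comm b a, hsym b a]
      split_ifs <;> ring
    have e2 : v ⬝ᵥ L.mulVec v + v ⬝ᵥ L.mulVec v = ∑ a, ∑ b, f a b := by
      conv_lhs => 
        congr
        · rw [e0]
        · rw [e1]
      simp only [← Finset.sum_add_distrib]
      refine Finset.sum_congr rfl fun a _ => Finset.sum_congr rfl fun b _ => ?_
      simp only [f]
      split_ifs with h
      · rcases hσ a b h with h | h <;> rw [h] <;> ring
      · simp
    linarith
  have h3 : ∑ a, ∑ b, T a b * f a b = ∑ a, ∑ b, T b a * f a b := by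
    rw [Finset.sum_comm]
    exact Finset.sum_congr rfl fun a _ => Finset.sum_congr rfl fun b _ => by rw [hfs]
  have h4 : ∑ a, ∑ b, T a b * f a b + ∑ a, ∑ b, T b a * f a b ≤ ∑ a, ∑ b, f a b := by
    simp only [← Finset.sum_add_distrib]
    refine Finset.sum_le_sum fun a _ => Finset.sum_le_sum fun b _ => ?_
    nlinarith [hT a b, hf0 a b]
  linarith

/-- If R = {u₁,…,u_k} is a vertex subset of a connected signed graph such that
the induced edges form a matching of size r, then the sum of the k largest
Laplacian eigenvalues is at least Σ d(uᵢ) + k − r. -/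
theorem stmt_14 {n : ℕ} (hn : 2 < n) (G : SimpleGraph (Fin n)) [DecidableRel G.Adj]
    (hconn : G.Connected)
    (σ : Fin n → Fin n → ℝ)
    (hσ : ∀ i j, G.Adj i j → σ i j = 1 ∨ σ i j = -1)
    (hsym : ∀ i j, σ i j = σ j i)
    (L : Matrix (Fin n) (Fin n) ℝ)
    (hL : L = fun i j => (if i = j then (G.degree i : ℝ) else 0) -
      (if G.Adj i j then σ i j else 0))
    (μ : Fin n → ℝ) (hmono : Antitone μ)
    (hchar : L.charpoly = ∏ i, (X - C (μ i)))
    (R : Finset (Fin n)) (k : ℕ) (hk : R.card = k)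
    (r : ℕ)
    (hmatch : ∃ e : Fin r → Fin n × Fin n,
      (∀ i, (e i).1 ∈ R ∧ (e i).2 ∈ R ∧ G.Adj (e i).1 (e i).2) ∧
      Function.Injective (fun x : Fin r × Bool =>
        if x.2 then (e x.1).1 else (e x.1).2) ∧
      (∀ a ∈ R, ∀ b ∈ R, G.Adj a b → ∃ i, (a, b) = e i ∨ (b, a) = e i)) :
    (∑ u ∈ R, (G.degree u : ℝ)) + k - r ≤
      ∑ i ∈ Finset.univ.filter (fun i : Fin n => (i : ℕ) < k), μ i := by
  classical
  -- choose orientation of the matching edges so that the tail has degree at least two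
  obtain ⟨p, q, hpq, hpdeg, hpinj, hcov⟩ : ∃ p q : Fin r → Fin n,
      (∀ i, G.Adj (p i) (q i)) ∧ (∀ i, 2 ≤ G.degree (p i)) ∧ Function.Injective p ∧
      (∀ a ∈ R, ∀ b ∈ R, G.Adj a b → ∃ i, (a = p i ∧ b = q i) ∨ (b = p i ∧ a = q i)) := by
    obtain ⟨e, he, hinj, hcov⟩ := hmatch
    refine ⟨fun i => if 2 ≤ G.degree (e i).1 then (e i).1 else (e i).2,
      fun i => if 2 ≤ G.degree (e i).1 then (e i).2 else (e i).1, ?_, ?_, ?_, ?_⟩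
    · intro i
      dsimp only
      split_ifs
      · exact (he i).2.2
      · exact (he i).2.2.symm
    · intro i
      have hd : ∀ x y, x = y → 2 ≤ G.degree y → 2 ≤ G.degree x := by
        rintro x _ rfl h
        exact h
      by_cases h : 2 ≤ G.degree (e i).1
      · exact hd _ _ (if_pos h) h
      · exact hd _ _ (if_neg h) (aux_two hn G hconn _ _ (he i).2.2 (by omega))
    · intro i j hij
      have := @hinj (i, decide (2 ≤ G.degree (e i).1)) (j, decide (2 ≤ G.degree (e j).1))
        (by simpa using hij)
      exact (Prod.ext_iff.1 this).1
    · intro a ha b hb hab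
      obtain ⟨i, hi⟩ := hcov a ha b hb hab
      refine ⟨i, ?_⟩
      dsimp only
      rcases hi with hi | hi <;> rw [← hi] <;> split_ifs <;> simp
  let S : Fin n → Finset (Fin n) := fun u =>
    (G.neighborFinset u).filter (fun w => ¬ ∃ i, u = p i ∧ w = q i)
  have hS : ∀ u, ∀ w ∈ S u, G.Adj u w := by
    intro u w hw
    simpa using (Finset.mem_filter.1 hw).1
  have hdis : ∀ a ∈ R, ∀ b ∈ R, b ∈ S a → a ∉ S b := by
    intro a ha b hb h1 h2
    have n1 := (Finset.mem_filter.1 h1).2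
    have n2 := (Finset.mem_filter.1 h2).2
    obtain ⟨i, hi | hi⟩ := hcov a ha b hb (hS a b h1)
    · exact n1 ⟨i, hi⟩
    · exact n2 ⟨i, hi⟩
  have hScard : ∀ u, G.degree u ≤ (S u).card + (univ.filter (fun i => p i = u)).card := by
    intro u
    rw [← G.card_neighborFinset_eq_degree, ← Finset.card_filter_add_card_filter_not
      (s := G.neighborFinset u) (fun w => ¬ ∃ i, u = p i ∧ w = q i)]
    refine Nat.add_le_add_left ?_ _
    refine (Finset.card_le_card (t := (univ.filter (fun i => p i = u)).image q) ?_).trans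
      Finset.card_image_le
    intro w hw
    have := (Finset.mem_filter.1 hw).2
    push Not at this
    obtain ⟨i, hi, hi'⟩ := this
    exact Finset.mem_image.2 ⟨i, by simp [hi], hi'.symm⟩
  have hSpos : ∀ u, 0 < (S u).card := by
    intro u
    have h1 := hScard u
    have h2 : (univ.filter (fun i => p i = u)).card ≤ 1 := by
      refine Finset.card_le_one.2 fun a ha b hb => hpinj ?_
      rw [(Finset.mem_filter.1 ha).2, (Finset.mem_filter.1 hb).2]
    by_cases hu : ∃ i, p i = u
    · obtain ⟨i, rfl⟩ := hu
      have := hpdeg i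
      omega
    · have h3 : univ.filter (fun i => p i = u) = ∅ := by
        ext i; simpa using fun h => hu ⟨i, h⟩
      rw [h3, Finset.card_empty] at h1
      have : 0 < G.degree u := by
        have : Nontrivial (Fin n) := Fin.nontrivial_iff_two_le.2 (by omega)
        exact hconn.preconnected.degree_pos_of_nontrivial u
      omega
  let z : Fin n → EuclideanSpace ℝ (Fin n) := fun u =>
    WithLp.toLp 2 (fun x => (√((S u).card : ℝ))⁻¹ *
      (if x = u then ((S u).card : ℝ) else if x ∈ S u then - σ u x else 0))
  have huS : ∀ u, u ∉ S u := fun u h => G.loopless.irrefl u (hS u u h)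
  have hzn : ∀ u, ‖z u‖ ^ 2 = (S u).card + 1 := by
    intro u
    have hpos : (0 : ℝ) < (S u).card := by exact_mod_cast hSpos u
    rw [EuclideanSpace.norm_sq_eq]
    simp only [z, Real.norm_eq_abs, sq_abs, mul_pow]
    rw [← Finset.mul_sum, inv_pow, Real.sq_sqrt hpos.le]
    have : ∀ x, (if x = u then ((S u).card : ℝ) else if x ∈ S u then - σ u x else 0) ^ 2
        = (if x = u then ((S u).card : ℝ) ^ 2 else 0) + (if x ∈ S u then 1 else 0) := by
      intro x
      by_cases hx : x = u
      · subst hx; simp [huS]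
      · by_cases hx2 : x ∈ S u
        · rcases hσ u x (hS u x hx2) with h | h <;> simp [hx, hx2, h]
        · simp [hx, hx2]
    simp only [this, Finset.sum_add_distrib]
    simp
    field_simp
  have hzi : ∀ (v : EuclideanSpace ℝ (Fin n)) u,
      (inner ℝ v (z u)) ^ 2 ≤ ∑ w ∈ S u, (v.ofLp u - σ u w * v.ofLp w) ^ 2 := by
    intro v u
    have hpos : (0 : ℝ) < (S u).card := by exact_mod_cast hSpos u
    have h1 : inner ℝ v (z u) = (√((S u).card : ℝ))⁻¹ * ∑ w ∈ S u, (v.ofLp u - σ u w * v.ofLp w) := by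
      rw [PiLp.inner_apply]
      have : ∀ x, inner ℝ (v.ofLp x) ((z u).ofLp x) = (√((S u).card : ℝ))⁻¹ *
          ((if x = u then ((S u).card : ℝ) * v.ofLp u else 0)
            + (if x ∈ S u then - σ u x * v.ofLp x else 0)) := by
        intro x
        simp only [z]
        by_cases hx : x = u
        · subst hx; simp [huS]; ring
        · by_cases hx2 : x ∈ S u
          · simp [hx, hx2]; ring
          · simp [hx, hx2]
      simp only [this, ← Finset.mul_sum, Finset.sum_add_distrib, Finset.sum_sub_distrib]
      simp [Finset.sum_ite_mem]
      left; ring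
    rw [h1, mul_pow, inv_pow, Real.sq_sqrt hpos.le]
    have := sq_sum_le_card_mul_sum_sq (s := S u) (f := fun w => v.ofLp u - σ u w * v.ofLp w)
    rw [inv_mul_le_iff₀ hpos]
    exact this
  have hherm : L.IsHermitian := by
    ext i j
    rw [Matrix.conjTranspose_apply, star_trivial, hL]
    simp only [G.adj_comm j i, hsym j i]
    by_cases h : i = j
    · subst h; rfl
    · simp [h, Ne.symm h]
  have hkn : k ≤ n := by
    rw [← hk]; simpa using Finset.card_le_univ R
  have hfin := aux_main (by omega) hkn L hherm μ hmono hchar R hk z (fun v =>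
    (Finset.sum_le_sum fun u _ => hzi v u).trans
      (aux_lower G σ hσ hsym L hL R S hS hdis v.ofLp))
  refine le_trans ?_ hfin
  simp only [hzn, Finset.sum_add_distrib]
  have h1 : ∑ u ∈ R, G.degree u ≤ ∑ u ∈ R, (S u).card + r := by
    refine (Finset.sum_le_sum fun u _ => hScard u).trans ?_
    rw [Finset.sum_add_distrib]
    refine Nat.add_le_add_left ?_ _
    calc ∑ u ∈ R, (univ.filter (fun i => p i = u)).card
        ≤ ∑ u, (univ.filter (fun i => p i = u)).card :=
          Finset.sum_le_sum_of_subset (Finset.subset_univ _)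
      _ = (univ : Finset (Fin r)).card :=
          (Finset.card_eq_sum_card_fiberwise (fun _ _ => Finset.mem_coe.2 (Finset.mem_univ _))).symm
      _ = r := by simp
  have h2 : (∑ u ∈ R, (G.degree u : ℝ)) ≤ ∑ u ∈ R, ((S u).card : ℝ) + r := by exact_mod_cast h1
  simp [hk]
  linarith
end

section
/- Let Γ = (G, σ) be a connected signed graph on n > 2 vertices. Then μ₁(Γ) + μ₂(Γ) ≥ d₁(Γ) + d₂(Γ) + 1, where μᵢ are the Laplacian eigenvalues in non-increasing order and d₁ ≥ d₂ are the two largest vertex degrees. Moreover, if two nonadjacent vertices realize degrees d₁(Γ) and d₂(Γ), then μ₁(Γ) + μ₂(Γ) ≥ d₁(Γ) + d₂(Γ) + 2. -/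
open Matrix Polynomial

theorem ky {n : ℕ} (i0 i1 : Fin n) (hi0 : i0.val = 0) (hi1 : i1.val = 1) (L : Matrix (Fin n) (Fin n) ℝ) (hA : L.IsHermitian)
    (μ : Fin n → ℝ) (hmono : Antitone μ) (p : Equiv.Perm (Fin n))
    (hp : ∀ i, hA.eigenvalues (p i) = μ i)
    (w z : EuclideanSpace ℝ (Fin n))
    (h : ∀ x : EuclideanSpace ℝ (Fin n), inner ℝ x w ^ 2 + inner ℝ x z ^ 2 ≤ x.ofLp ⬝ᵥ L *ᵥ x.ofLp) :
    ‖w‖^2 + ‖z‖^2 ≤ μ i0 + μ i1 := by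
  have hQ : ∀ x : EuclideanSpace ℝ (Fin n), x.ofLp ⬝ᵥ L *ᵥ x.ofLp =
      ∑ i, μ i * inner ℝ (hA.eigenvectorBasis (p i)) x ^ 2 := by
    intro x
    have h1 : x.ofLp ⬝ᵥ L *ᵥ x.ofLp = inner ℝ x (WithLp.toLp 2 (L *ᵥ x.ofLp)) := by
      rw [EuclideanSpace.inner_eq_star_dotProduct]
      simp [dotProduct_comm]
    rw [h1, ← OrthonormalBasis.sum_inner_mul_inner hA.eigenvectorBasis, ← Equiv.sum_comp p]
    refine Finset.sum_congr rfl fun i _ => ?_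
    have h2 : inner ℝ (hA.eigenvectorBasis (p i)) (WithLp.toLp 2 (L *ᵥ x.ofLp)) =
        μ i * inner ℝ (hA.eigenvectorBasis (p i)) x := by
      rw [EuclideanSpace.inner_eq_star_dotProduct, EuclideanSpace.inner_eq_star_dotProduct]
      have := hA.mulVec_eigenvectorBasis (p i)
      simp only [star_trivial]
      rw [dotProduct_comm, dotProduct_mulVec, ← mulVec_transpose]
      have hT : Lᵀ = L := by simpa using hA.eq
      rw [hT, this, hp, smul_dotProduct, dotProduct_comm, smul_eq_mul]
    rw [h2, real_inner_comm]; ring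
  set f : Fin n → EuclideanSpace ℝ (Fin n) := fun i => if i.val = 0 then w else if i.val = 1 then z else 0 with hf
  set b := InnerProductSpace.gramSchmidtOrthonormalBasis (𝕜 := ℝ) (by simp) f with hb
  have hne : i0 ≠ i1 := by
    intro h
    have := congrArg Fin.val h
    omega
  have tri : ∀ i j : Fin n, i < j → inner ℝ (b j) (f i) = 0 := fun i j hij =>
    InnerProductSpace.gramSchmidtOrthonormalBasis_inv_triangular _ f hij
  have hsum : ∀ u : EuclideanSpace ℝ (Fin n), (∀ j : Fin n, j ≠ i0 → j ≠ i1 → inner ℝ (b j) u = 0) →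
      ‖u‖^2 = inner ℝ (b i0) u ^2 + inner ℝ (b i1) u ^ 2 := by
    intro u hu
    rw [← b.sum_sq_inner_right, ← Finset.sum_pair (f := fun i => inner ℝ (b i) u ^ 2) hne]
    symm
    apply Finset.sum_subset (Finset.subset_univ _)
    intro j _ hj
    simp only [Finset.mem_insert, Finset.mem_singleton, not_or] at hj
    rw [hu j hj.1 hj.2]; simp
  have hw := hsum w (fun j h0 h1 => by
    have := tri i0 j (by
      have h0' : j.val ≠ 0 := fun h => h0 (Fin.ext (by omega))
      show i0.val < j.val
      omega)
    simpa [hf, hi0] using this)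
  have hz := hsum z (fun j h0 h1 => by
    have := tri i1 j (by
      have h0' : j.val ≠ 0 := fun h => h0 (Fin.ext (by omega))
      have h1' : j.val ≠ 1 := fun h => h1 (Fin.ext (by omega))
      show i1.val < j.val
      omega)
    simpa [hf, hi1] using this)
  have hx := h (b i0)
  have hy := h (b i1)
  rw [hQ] at hx hy
  set v := fun i => hA.eigenvectorBasis (p i) with hv
  set c : Fin n → ℝ := fun i => inner ℝ (v i) (b i0) ^ 2 + inner ℝ (v i) (b i1) ^ 2 with hc
  have hc0 : ∀ i, 0 ≤ c i := fun i => by positivity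
  have hc1 : ∀ i, c i ≤ 1 := by
    intro i
    have h1 : ‖v i‖^2 = 1 := by simp [hv]
    rw [← h1, ← b.sum_sq_inner_left]
    simp only [hc]
    rw [← Finset.sum_pair (f := fun j => inner ℝ (v i) (b j) ^ 2) hne]
    exact Finset.sum_le_sum_of_subset_of_nonneg (Finset.subset_univ _) (fun _ _ _ => by positivity)
  have hcs : ∑ i, c i = 2 := by
    have h1 : ∀ u : EuclideanSpace ℝ (Fin n), ∑ i, inner ℝ (v i) u ^ 2 = ‖u‖^2 := fun u => by
      rw [← hA.eigenvectorBasis.sum_sq_inner_right]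
      exact Equiv.sum_comp p (fun i => inner ℝ (hA.eigenvectorBasis i) u ^ 2)
    simp only [hc, Finset.sum_add_distrib, h1]
    simp; norm_num
  have hfin : ∑ i, μ i * c i ≤ μ i0 + μ i1 := by
    have h1 : ∑ i, (μ i - μ i1) * c i ≤ ∑ i, if i = i0 then μ i0 - μ i1 else 0 := by
      apply Finset.sum_le_sum
      intro i _
      split_ifs with hi
      · rw [hi]
        have : μ i1 ≤ μ i0 := hmono (show i0.val ≤ i1.val by omega)
        nlinarith [hc1 i0]
      · have : μ i ≤ μ i1 := hmono (by
          have h0' : i.val ≠ 0 := fun h => hi (Fin.ext (by omega))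
          show i.val ≥ i1.val
          omega)
        nlinarith [hc0 i]
    simp only [sub_mul, Finset.sum_sub_distrib, ← Finset.mul_sum, hcs] at h1
    simp at h1
    linarith
  simp only [hc, mul_add, Finset.sum_add_distrib] at hfin
  simp only [hv] at hfin
  linarith

theorem getp {n : ℕ} (μ l : Fin n → ℝ)
    (h : ∏ i, (X - C (μ i)) = ∏ i, (X - C (l i))) : ∃ p : Equiv.Perm (Fin n), ∀ i, l (p i) = μ i := by
  have h1 : Finset.univ.val.map μ = Finset.univ.val.map l := by
    have := congrArg roots h
    rw [Polynomial.roots_prod _ _ (by simp [Finset.prod_ne_zero_iff, Polynomial.X_sub_C_ne_zero]),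
      Polynomial.roots_prod _ _ (by simp [Finset.prod_ne_zero_iff, Polynomial.X_sub_C_ne_zero])] at this
    simpa using this
  have h2 : ∀ r, Fintype.card {i // μ i = r} = Fintype.card {i // l i = r} := by
    intro r
    have := congrArg (Multiset.count r) h1
    simp only [Multiset.count_map] at this
    rw [Fintype.card_subtype, Fintype.card_subtype]
    simpa [Finset.card_def, Finset.filter_val, eq_comm] using this
  let E : ∀ r, {i // μ i = r} ≃ {i // l i = r} := fun r => Fintype.equivOfCardEq (h2 r)
  refine ⟨(Equiv.sigmaFiberEquiv μ).symm.trans ((Equiv.sigmaCongrRight E).trans (Equiv.sigmaFiberEquiv l)), ?_⟩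
  intro i
  exact (E (μ i) ⟨i, rfl⟩).2

theorem star_vec {n : ℕ} (a : Fin n) (S : Finset (Fin n)) (ha : a ∉ S) (hS : S.Nonempty)
    (s : Fin n → ℝ) (hs : ∀ j ∈ S, s j ^ 2 = 1) :
    ∃ w : EuclideanSpace ℝ (Fin n), ‖w‖ ^ 2 = (S.card : ℝ) + 1 ∧
      ∀ x : EuclideanSpace ℝ (Fin n), inner ℝ x w ^ 2 ≤ ∑ j ∈ S, (x a - s j * x j) ^ 2 := by
  have hk : (0 : ℝ) < S.card := by exact_mod_cast hS.card_pos
  set k : ℝ := (S.card : ℝ) with hkd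
  set r : ℝ := (√k)⁻¹ with hr
  have hr2 : r ^ 2 * k = 1 := by
    rw [hr, inv_pow, Real.sq_sqrt hk.le]; field_simp
  refine ⟨WithLp.toLp 2 (fun i => r * ((if i = a then k else 0) - if i ∈ S then s i else 0)), ?_, ?_⟩
  · rw [EuclideanSpace.real_norm_sq_eq]
    have : ∀ i, (r * ((if i = a then k else 0) - if i ∈ S then s i else 0)) ^ 2 =
        r ^ 2 * ((if i = a then k ^ 2 else 0) + if i ∈ S then 1 else 0) := by
      intro i
      by_cases h1 : i = a
      · subst h1; simp [ha]; ring
      · by_cases h2 : i ∈ S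
        · simp [h1, h2, mul_pow, hs i h2]
        · simp [h1, h2]
    simp only [this]
    rw [← Finset.mul_sum, Finset.sum_add_distrib]
    simp
    rw [← hkd]
    linear_combination (k + 1) * hr2
  · intro x
    have h1 : inner ℝ x (WithLp.toLp 2 (fun i => r * ((if i = a then k else 0) - if i ∈ S then s i else 0)))
        = r * ∑ j ∈ S, (x a - s j * x j) := by
      rw [EuclideanSpace.inner_eq_star_dotProduct]
      simp only [dotProduct, star_trivial, mul_assoc, ← Finset.mul_sum, sub_mul, Finset.sum_sub_distrib]
      congr 1
      simp [hkd]
    rw [h1, mul_pow]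
    have h2 := sq_sum_le_card_mul_sum_sq (s := S) (f := fun j => x a - s j * x j)
    calc _ ≤ r ^ 2 * (k * ∑ j ∈ S, (x a - s j * x j) ^ 2) := by gcongr
      _ = _ := by rw [← mul_assoc, hr2, one_mul]

theorem ind_le {n : ℕ} (a b : Fin n) (hab : a ≠ b) (S T : Finset (Fin n)) (ha : a ∉ S) (hb : b ∉ T)
    (hST : b ∈ S → a ∈ T → False) (i j : Fin n) (F : ℝ) (hF : 0 ≤ F) :
    ((if i = a then if j ∈ S then F else 0 else 0) +
      (if i = b then if j ∈ T then F else 0 else 0)) +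
      ((if j = a then if i ∈ S then F else 0 else 0) +
      (if j = b then if i ∈ T then F else 0 else 0)) ≤ F := by
  split_ifs <;> first | linarith | (exfalso; subst_vars; tauto)

theorem quad_lb {n : ℕ} (G : SimpleGraph (Fin n)) [DecidableRel G.Adj]
    (σ : Fin n → Fin n → ℝ)
    (hσ : ∀ i j, G.Adj i j → σ i j = 1 ∨ σ i j = -1)
    (hsym : ∀ i j, σ i j = σ j i)
    (L : Matrix (Fin n) (Fin n) ℝ)
    (hL : L = fun i j => (if i = j then (G.degree i : ℝ) else 0) -
      (if G.Adj i j then σ i j else 0))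
    (a b : Fin n) (hab : a ≠ b) (S T : Finset (Fin n)) (hS : ∀ j ∈ S, G.Adj a j)
    (hT : ∀ j ∈ T, G.Adj b j) (hST : b ∈ S → a ∈ T → False) (x : Fin n → ℝ) :
    ∑ j ∈ S, (x a - σ a j * x j) ^ 2 + ∑ j ∈ T, (x b - σ b j * x j) ^ 2 ≤ x ⬝ᵥ L *ᵥ x := by
  have hσ2 : ∀ i j, G.Adj i j → σ i j ^ 2 = 1 := fun i j h => by
    rcases hσ i j h with h | h <;> rw [h] <;> norm_num
  set f : Fin n → Fin n → ℝ := fun i j => if G.Adj i j then (x i - σ i j * x j) ^ 2 else 0 with hf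
  have hf0 : ∀ i j, 0 ≤ f i j := fun i j => by simp only [hf]; split_ifs <;> positivity
  have hfs : ∀ i j, f i j = f j i := by
    intro i j
    simp only [hf, G.adj_comm j i]
    split_ifs with h
    · rw [hsym j i]
      linear_combination (x j ^ 2 - x i ^ 2) * hσ2 i j h
    · rfl
  have hq : 2 * (x ⬝ᵥ L *ᵥ x) = ∑ i, ∑ j, f i j := by
    have hdeg : ∀ i, (G.degree i : ℝ) = ∑ j, if G.Adj i j then 1 else 0 := by
      intro i
      rw [← G.card_neighborFinset_eq_degree, G.neighborFinset_eq_filter]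
      simp
    have e1 : x ⬝ᵥ L *ᵥ x = ∑ i, ∑ j, ((if G.Adj i j then x i ^ 2 else 0)
        - if G.Adj i j then σ i j * x i * x j else 0) := by
      simp only [dotProduct, mulVec, hL]
      refine Finset.sum_congr rfl fun i _ => ?_
      simp only [sub_mul, Finset.sum_sub_distrib, mul_sub]
      congr 1
      · rw [hdeg]
        simp only [ite_mul, zero_mul, Finset.sum_ite_eq, Finset.mem_univ, if_true]
        rw [Finset.sum_mul, Finset.mul_sum]
        refine Finset.sum_congr rfl fun j _ => ?_
        split_ifs <;> ring
      · rw [Finset.mul_sum]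
        refine Finset.sum_congr rfl fun j _ => ?_
        split_ifs <;> ring
    have e2 : ∑ i, ∑ j, (if G.Adj i j then x i ^ 2 else 0) =
        ∑ i, ∑ j, (if G.Adj i j then x j ^ 2 else 0) := by
      rw [Finset.sum_comm]
      simp only [G.adj_comm]
    have e3 : ∀ i j, f i j = (if G.Adj i j then x i ^ 2 else 0) + (if G.Adj i j then x j ^ 2 else 0)
        - 2 * (if G.Adj i j then σ i j * x i * x j else 0) := by
      intro i j
      simp only [hf]
      split_ifs with h
      · linear_combination (x j ^ 2) * hσ2 i j h
      · ring
    simp only [e1, e3, Finset.sum_sub_distrib, Finset.sum_add_distrib, ← Finset.mul_sum]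
    linarith
  have key : ∀ i j, ((if i = a then if j ∈ S then f i j else 0 else 0) +
      (if i = b then if j ∈ T then f i j else 0 else 0)) +
      ((if j = a then if i ∈ S then f i j else 0 else 0) +
      (if j = b then if i ∈ T then f i j else 0 else 0)) ≤ f i j := by
    intro i j
    have := hf0 i j
    have ha : a ∉ S := fun h => G.loopless.irrefl _ (hS a h)
    have hb : b ∉ T := fun h => G.loopless.irrefl _ (hT b h)
    exact ind_le a b hab S T ha hb hST i j (f i j) this
  have hsumS : ∀ (c : Fin n) (U : Finset (Fin n)), (∀ j ∈ U, G.Adj c j) →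
      ∑ i, ∑ j, (if i = c then if j ∈ U then f i j else 0 else 0) = ∑ j ∈ U, (x c - σ c j * x j) ^ 2 := by
    intro c U hU
    rw [Finset.sum_eq_single c (by intro i _ h; simp [h]) (by simp)]
    simp only [if_true]
    rw [← Finset.sum_filter, Finset.filter_mem_eq_inter, Finset.univ_inter]
    refine Finset.sum_congr rfl fun j hj => ?_
    simp [hf, hU j hj]
  have hsumS' : ∀ (c : Fin n) (U : Finset (Fin n)), (∀ j ∈ U, G.Adj c j) →
      ∑ i, ∑ j, (if j = c then if i ∈ U then f i j else 0 else 0) = ∑ j ∈ U, (x c - σ c j * x j) ^ 2 := by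
    intro c U hU
    rw [← hsumS c U hU, Finset.sum_comm]
    simp only [fun i j => hfs j i]
  have hle := Finset.sum_le_sum fun i (_ : i ∈ Finset.univ) =>
    Finset.sum_le_sum fun j (_ : j ∈ Finset.univ) => key i j
  simp only [Finset.sum_add_distrib, hsumS a S hS, hsumS b T hT, hsumS' a S hS, hsumS' b T hT] at hle
  linarith

theorem main_lb {n : ℕ} (i0 i1 : Fin n) (hi0 : i0.val = 0) (hi1 : i1.val = 1) (G : SimpleGraph (Fin n)) [DecidableRel G.Adj]
    (σ : Fin n → Fin n → ℝ)
    (hσ : ∀ i j, G.Adj i j → σ i j = 1 ∨ σ i j = -1)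
    (hsym : ∀ i j, σ i j = σ j i)
    (L : Matrix (Fin n) (Fin n) ℝ)
    (hL : L = fun i j => (if i = j then (G.degree i : ℝ) else 0) -
      (if G.Adj i j then σ i j else 0))
    (μ : Fin n → ℝ) (hmono : Antitone μ)
    (hchar : L.charpoly = ∏ i, (X - C (μ i)))
    (a b : Fin n) (hab : a ≠ b) (S T : Finset (Fin n)) (hS : ∀ j ∈ S, G.Adj a j)
    (hT : ∀ j ∈ T, G.Adj b j) (hST : b ∈ S → a ∈ T → False)
    (hS0 : S.Nonempty) (hT0 : T.Nonempty) :
    (S.card : ℝ) + T.card + 2 ≤ μ i0 + μ i1 := by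
  have hσ2 : ∀ i j, G.Adj i j → σ i j ^ 2 = 1 := fun i j h => by
    rcases hσ i j h with h | h <;> rw [h] <;> norm_num
  have hA : L.IsHermitian := by
    ext i j
    rw [conjTranspose_apply, star_trivial, hL]
    simp only [G.adj_comm j i, hsym j i]
    by_cases h : i = j
    · subst h; rfl
    · simp [h, Ne.symm h]
  obtain ⟨p, hp⟩ := getp μ hA.eigenvalues (by
    rw [← hchar]; simpa using hA.charpoly_eq)
  obtain ⟨w, hw, hw'⟩ := star_vec a S (fun h => G.loopless.irrefl _ (hS a h)) hS0 (σ a)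
    (fun j hj => hσ2 _ _ (hS j hj))
  obtain ⟨z, hz, hz'⟩ := star_vec b T (fun h => G.loopless.irrefl _ (hT b h)) hT0 (σ b)
    (fun j hj => hσ2 _ _ (hT j hj))
  have := ky i0 i1 hi0 hi1 L hA μ hmono p hp w z (fun x => (add_le_add (hw' x) (hz' x)).trans
    (quad_lb G σ hσ hsym L hL a b hab S T hS hT hST x))
  linarith

/-- For a connected signed graph on n > 2 vertices,
μ₁ + μ₂ ≥ d₁ + d₂ + 1; if two nonadjacent vertices realize the two largest
degrees, then μ₁ + μ₂ ≥ d₁ + d₂ + 2. -/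
theorem stmt_17 {n : ℕ} (hn : 2 < n) (G : SimpleGraph (Fin n)) [DecidableRel G.Adj]
    (hconn : G.Connected)
    (σ : Fin n → Fin n → ℝ)
    (hσ : ∀ i j, G.Adj i j → σ i j = 1 ∨ σ i j = -1)
    (hsym : ∀ i j, σ i j = σ j i)
    (L : Matrix (Fin n) (Fin n) ℝ)
    (hL : L = fun i j => (if i = j then (G.degree i : ℝ) else 0) -
      (if G.Adj i j then σ i j else 0))
    (μ : Fin n → ℝ) (hmono : Antitone μ)
    (hchar : L.charpoly = ∏ i, (X - C (μ i)))
    (d : Fin n → ℕ) (hd : Antitone d)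
    (e : Fin n ≃ Fin n) (hde : ∀ i, d i = G.degree (e i)) :
    ((d ⟨0, by omega⟩ : ℝ) + (d ⟨1, by omega⟩ : ℝ) + 1 ≤
        μ ⟨0, by omega⟩ + μ ⟨1, by omega⟩) ∧
    ((∃ a b : Fin n, a ≠ b ∧ ¬ G.Adj a b ∧
        G.degree a = d ⟨0, by omega⟩ ∧ G.degree b = d ⟨1, by omega⟩) →
      (d ⟨0, by omega⟩ : ℝ) + (d ⟨1, by omega⟩ : ℝ) + 2 ≤
        μ ⟨0, by omega⟩ + μ ⟨1, by omega⟩) := by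
  have : Nontrivial (Fin n) := Fin.nontrivial_iff_two_le.mpr (by omega)
  have hpos : ∀ v, 0 < G.degree v := fun v => hconn.preconnected.degree_pos_of_nontrivial v
  have hne : ∀ v, (G.neighborFinset v).Nonempty := fun v => by
    rw [← Finset.card_pos, G.card_neighborFinset_eq_degree]; exact hpos v
  have part2 : ∀ a b : Fin n, a ≠ b → ¬ G.Adj a b →
      (G.degree a : ℝ) + G.degree b + 2 ≤ μ ⟨0, by omega⟩ + μ ⟨1, by omega⟩ := by
    intro a b hab hadj
    have := main_lb ⟨0, by omega⟩ ⟨1, by omega⟩ rfl rfl G σ hσ hsym L hL μ hmono hchar a b hab (G.neighborFinset a)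
      (G.neighborFinset b) (by simp) (by simp) (by simp [hadj]) (hne a) (hne b)
    simpa using this
  have part1 : ∀ a b : Fin n, a ≠ b → G.Adj a b → 2 ≤ G.degree a →
      (G.degree a : ℝ) + G.degree b + 1 ≤ μ ⟨0, by omega⟩ + μ ⟨1, by omega⟩ := by
    intro a b hab hadj h2
    have hmem : b ∈ G.neighborFinset a := by simpa using hadj
    have hc := Finset.card_erase_add_one hmem
    rw [G.card_neighborFinset_eq_degree] at hc
    have := main_lb ⟨0, by omega⟩ ⟨1, by omega⟩ rfl rfl G σ hσ hsym L hL μ hmono hchar a b hab ((G.neighborFinset a).erase b)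
      (G.neighborFinset b) (by simp) (by simp) (by simp)
      (by rw [← Finset.card_pos]; omega) (hne b)
    rw [G.card_neighborFinset_eq_degree] at this
    have hc' : (((G.neighborFinset a).erase b).card : ℝ) + 1 = G.degree a := by exact_mod_cast hc
    linarith
  refine ⟨?_, ?_⟩
  · rw [hde, hde]
    set a := e ⟨0, by omega⟩ with ha
    set b := e ⟨1, by omega⟩ with hb
    have hab : a ≠ b := by
      intro h
      have := e.injective h
      simp at this
    by_cases hadj : G.Adj a b
    · apply part1 a b hab hadj
      by_contra hlt
      have h01 : ∀ v, G.degree v ≤ G.degree a := by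
        intro v
        have := hd (show (⟨0, by omega⟩ : Fin n) ≤ e.symm v from Nat.zero_le _)
        rw [hde, hde, Equiv.apply_symm_apply] at this
        exact this
      -- all degrees are one
      have h1 : ∀ v, G.degree v = 1 := fun v => by
        have := h01 v; have := hpos v; omega
      have huniq : ∀ v u u', G.Adj v u → G.Adj v u' → u = u' := by
        intro v u u' h h'
        have hc : (G.neighborFinset v).card ≤ 1 := by
          rw [G.card_neighborFinset_eq_degree, h1]
        exact Finset.card_le_one.mp hc u (by simpa using h) u' (by simpa using h')
      have hall : ∀ v, v = a ∨ v = b := by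
        intro v
        have hr := (SimpleGraph.reachable_iff_reflTransGen a v).mp (hconn.preconnected a v)
        induction hr with
        | refl => exact Or.inl rfl
        | tail _ hadj' ih =>
          rcases ih with h | h
          · subst h; exact Or.inr (huniq _ _ _ hadj' hadj)
          · subst h; exact Or.inl (huniq _ _ _ hadj' hadj.symm)
      have hcard : Fintype.card (Fin n) ≤ ({a, b} : Finset (Fin n)).card := by
        rw [← Finset.card_univ]
        apply Finset.card_le_card
        intro v _
        simpa using hall v
      have := Finset.card_le_two (a := a) (b := b)
      simp only [Fintype.card_fin] at hcard
      omega
    · linarith [part2 a b hab hadj]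
  · rintro ⟨a, b, hab, hadj, h0, h1⟩
    rw [← h0, ← h1]
    exact part2 a b hab hadj
end
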